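/- Let $A \in \mathbb{R}^{n \times n}$ be a symmetric matrix, let $A_k = A_{1:k,1:k}$ denote its leading principal $k \times k$ submatrix for $k = 1, \dotsc, n$, and set $d_0 = 1$ and $d_k = \det(A_k)$. Assume $d_k \neq 0$ for every $k = 1, \dotsc, n$. Then the number of negative eigenvalues of $A$, counted with multiplicity, equals the number of sign changes between consecutive elements of the sequence $d_0, d_1, \dotsc, d_n$, i.e., equals the number of indices $k \in \{1, \dotsc, n\}$ with $d_{k-1} d_k < 0$. -/

import Mathlib

open Matrix in
theorem aux_congr_sig {n : ℕ} (A P : Matrix (Fin n) (Fin n) ℝ) (w : Fin n → ℝ)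
    (hP : IsUnit P.det) (h : Pᵀ * A * P = diagonal w) :
    sigNeg (A.toQuadraticForm') = {i | w i < 0}.ncard := by
  apply QuadraticForm.sigNeg_of_equiv_weightedSumSquares
  refine QuadraticMap.Equivalent.symm ⟨⟨Matrix.toLinearEquiv' P (P.invertibleOfIsUnitDet hP), ?_⟩⟩
  intro x
  have : (A.toQuadraticForm') (P *ᵥ x) = x ⬝ᵥ ((Pᵀ * A * P) *ᵥ x) := by
    rw [Matrix.toQuadraticForm', LinearMap.BilinMap.toQuadraticMap_apply,
      Matrix.toLinearMap₂'_apply']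
    rw [← Matrix.mulVec_mulVec, ← Matrix.mulVec_mulVec, Matrix.dotProduct_mulVec x,
      Matrix.vecMul_transpose]
  refine Eq.trans this ?_
  rw [h, QuadraticMap.weightedSumSquares_apply]
  simp only [dotProduct, mulVec_diagonal, smul_eq_mul]
  exact Finset.sum_congr rfl fun i _ => by ring

open Matrix in
theorem aux_ldl (n : ℕ) (A : Matrix (Fin n) (Fin n) ℝ)
    (hA : A.IsSymm) (d : ℕ → ℝ)
    (hd : ∀ k : ℕ, (hk : k ≤ n) →
      d k = (A.submatrix (fun i : Fin k => Fin.castLE hk i)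
        (fun j : Fin k => Fin.castLE hk j)).det)
    (hnz : ∀ k : ℕ, k ≤ n → d k ≠ 0) :
    ∃ P : Matrix (Fin n) (Fin n) ℝ, IsUnit P.det ∧
      Pᵀ * A * P = diagonal (fun i : Fin n => d (i + 1) / d i) := by
  induction n with
  | zero => exact ⟨1, by simp, Subsingleton.elim _ _⟩
  | succ n ih =>
    let B := A.submatrix (Fin.castSucc : Fin n → _) Fin.castSucc
    obtain ⟨P, hP, hPB⟩ := ih B (hA.submatrix _)
      (fun k hk => (hd k (by omega)).trans rfl) (fun k hk => hnz k (by omega))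
    have hBd : B.det = d n := (hd n (by omega)).symm
    have hAd : A.det = d (n + 1) := (hd (n + 1) le_rfl).symm
    have hBu : IsUnit B.det := by rw [hBd]; exact (hnz n (by omega)).isUnit
    let e : Fin n ⊕ Fin 1 ≃ Fin (n + 1) := finSumFinEquiv
    let M := A.submatrix e e
    have hMs : Mᵀ = M := hA.submatrix _
    let C := M.toBlocks₁₂
    let D := M.toBlocks₂₂
    have hM : M = fromBlocks B C Cᵀ D := by
      rw [← fromBlocks_toBlocks M]
      congr 1
      ext i j
      exact congrFun (congrFun hMs.symm _) _
    have hMd : M.det = d (n + 1) := by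
      rw [← hAd]; exact det_submatrix_equiv_self e A
    have hBi : B⁻¹ᵀ = B⁻¹ := by
      rw [transpose_nonsing_inv, show Bᵀ = B from hA.submatrix _]
    have hS : (D - Cᵀ * B⁻¹ * C) = diagonal (fun _ : Fin 1 => d (n + 1) / d n) := by
      have : Invertible B := B.invertibleOfIsUnitDet hBu
      have h1 := det_fromBlocks₁₁ B C Cᵀ D
      rw [← hM, hMd, hBd, invOf_eq_nonsing_inv, det_fin_one] at h1
      ext i j
      fin_cases i; fin_cases j
      have := hnz n (by omega)
      simp only [Fin.zero_eta, diagonal_apply_eq]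
      field_simp
      rw [h1, mul_comm]
    let Q : Matrix (Fin n ⊕ Fin 1) (Fin n ⊕ Fin 1) ℝ := fromBlocks P (-(B⁻¹ * C)) 0 1
    have hQ : Qᵀ * M * Q = diagonal (Sum.elim (fun i : Fin n => d (i + 1) / d i)
        (fun _ : Fin 1 => d (n + 1) / d n)) := by
      rw [hM, ← fromBlocks_diagonal, ← hPB, ← hS]
      simp only [Q, fromBlocks_transpose, fromBlocks_multiply, transpose_neg, transpose_mul, hBi,
        transpose_zero, transpose_one, Matrix.zero_mul, Matrix.mul_zero, add_zero, zero_add,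
        Matrix.mul_one, Matrix.one_mul, Matrix.neg_mul, Matrix.mul_neg,
        Matrix.nonsing_inv_mul_cancel_right _ _ hBu]
      have e2 : Pᵀ * B * (B⁻¹ * C) = Pᵀ * C := by
        rw [Matrix.mul_assoc, mul_nonsing_inv_cancel_left _ _ hBu]
      congr 1
      · rw [e2]; simp
      · simp
      · rw [neg_add_cancel, Matrix.zero_mul]; abel
    refine ⟨Q.submatrix e.symm e.symm, ?_, ?_⟩
    · rw [det_submatrix_equiv_self]
      simpa [Q] using hP
    · have hAM : A = M.submatrix e.symm e.symm := by ext; simp [M]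
      rw [hAM, transpose_submatrix, submatrix_mul_equiv, submatrix_mul_equiv, hQ]
      rw [submatrix_diagonal_equiv]
      congr 1
      ext i
      obtain ⟨i, rfl⟩ := e.surjective i
      rcases i with i | i
      · simp [e]
      · fin_cases i; simp [e]

open Matrix in
/-- **Sturm Sequence Property.** The number of negative eigenvalues (with
multiplicity, i.e. negative real roots of the characteristic polynomial) of a
real symmetric matrix `A` equals the number of sign changes in the sequence
`1, det A₁, det A₂, …, det Aₙ` of determinants of leading principal
submatrices, provided none of these determinants vanishes. -/
theorem sturm_sequence_property (n : ℕ) (A : Matrix (Fin n) (Fin n) ℝ)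
    (hA : A.IsSymm) (d : ℕ → ℝ) (hd0 : d 0 = 1)
    (hd : ∀ k : ℕ, (hk : k ≤ n) →
      d k = (A.submatrix (fun i : Fin k => Fin.castLE hk i)
        (fun j : Fin k => Fin.castLE hk j)).det)
    (hnz : ∀ k : ℕ, 1 ≤ k → k ≤ n → d k ≠ 0) :
    (A.charpoly.roots.filter (fun x => x < 0)).card =
      ((Finset.Icc 1 n).filter (fun k => d (k - 1) * d k < 0)).card := by
  have hH : A.IsHermitian := hA
  have hnz' : ∀ k ≤ n, d k ≠ 0 := by
    intro k hk
    rcases Nat.eq_zero_or_pos k with rfl | h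
    · simp [hd0]
    · exact hnz k h hk
  obtain ⟨P, hP, hPA⟩ := aux_ldl n A hA d hd hnz'
  have h1 := aux_congr_sig A P _ hP hPA
  have h2 : sigNeg (A.toQuadraticForm') = {i | hH.eigenvalues i < 0}.ncard := by
    apply aux_congr_sig A (hH.eigenvectorUnitary : Matrix (Fin n) (Fin n) ℝ)
    · exact (Matrix.isUnit_iff_isUnit_det _).1 (Unitary.toUnits hH.eigenvectorUnitary).isUnit
    · have := hH.conjStarAlgAut_star_eigenvectorUnitary
      rw [Unitary.conjStarAlgAut_apply] at this
      simpa [star_eq_conjTranspose] using this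
  have h3 : (A.charpoly.roots.filter (fun x => x < 0)).card =
      {i | hH.eigenvalues i < 0}.ncard := by
    rw [hH.roots_charpoly_eq_eigenvalues, Multiset.filter_map, Multiset.card_map,
      Set.ncard_eq_toFinset_card']
    simp [Finset.card_def, Finset.filter_val, Function.comp_def]
  rw [h3, ← h2, h1, Set.ncard_eq_toFinset_card']
  refine Finset.card_bij (fun i _ => (i : ℕ) + 1) ?_ ?_ ?_
  · intro i hi
    simp only [Set.mem_toFinset, Set.mem_setOf_eq] at hi
    simp only [Finset.mem_filter, Finset.mem_Icc, Nat.add_sub_cancel]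
    refine ⟨⟨by omega, i.2⟩, ?_⟩
    rw [mul_comm]
    rwa [← mul_neg_iff.trans div_neg_iff.symm] at hi
  · intro i _ j _ h
    exact Fin.ext (by simpa using h)
  · intro k hk
    simp only [Finset.mem_filter, Finset.mem_Icc] at hk
    refine ⟨⟨k - 1, by omega⟩, ?_, by simp; omega⟩
    simp only [Set.mem_toFinset, Set.mem_setOf_eq]
    rw [← mul_neg_iff.trans div_neg_iff.symm, Nat.sub_add_cancel hk.1.1, mul_comm]
    exact hk.2
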